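/- arXiv:1608.04578 — 2 statements merged into one kernel-verified Lean document; each statement's English description precedes it below -/
import Mathlib

section
/- Let d ≥ 3 and N ∈ ℕ. Let C_N = ([0,N] × [−N,N]^{d−1}) ∩ H, where H = {x ∈ ℤ^d : x₁ ≥ 0}, and let G_{C_N}(x,y) = (1/π_H(y)) E_x[Σ_{m=0}^{τ_{C_N}} 1{S_m = y}] be the Green's function of the simple random walk on H killed upon leaving C_N, where τ_{C_N} = inf{m ≥ 0 : S_m ∉ C_N}. Let K_N = ([−N−1, N] × [−N,N]^{d−1}) ∩ ℤ^d and let g_{K_N} be the Green's function of the simple random walk on ℤ^d killed when leaving K_N. Then for all x, y ∈ H, G_{C_N}(x, y) = g_{K_N}(x, y) + g_{K_N}(x, ȳ − e₁), where ȳ = (−y₁, y₂, …, y_d) and e₁ is the first standard basis vector. -/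
open scoped ENNReal
open Filter

noncomputable section

variable {V : Type*}

/-- Total conductance (weight) `π(x) = Σ_y c(x,y)` at a vertex `x`. -/
def piW (c : V → V → ℝ≥0∞) (x : V) : ℝ≥0∞ := ∑' y, c x y

/-- One-step transition probability `c(x,y)/π(x)` of the random walk with conductances `c`. -/
def step (c : V → V → ℝ≥0∞) (x y : V) : ℝ≥0∞ := c x y / piW c x

/-- `n`-step transition probability of the random walk with conductances `c`. -/
def stepN [DecidableEq V] (c : V → V → ℝ≥0∞) : ℕ → V → V → ℝ≥0∞
  | 0, x, y => if x = y then 1 else 0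
  | n + 1, x, y => ∑' z, stepN c n x z * step c z y

/-- Green's function `G(x,y) = π(y)⁻¹ Σ_n p_n(x,y)` of the walk with conductances `c`. -/
def green [DecidableEq V] (c : V → V → ℝ≥0∞) (x y : V) : ℝ≥0∞ :=
  (piW c y)⁻¹ * ∑' n, stepN c n x y

/-- Nearest-neighbour adjacency on `ℤ^d`. -/
def latAdj {d : ℕ} (x y : Fin d → ℤ) : Prop := (∑ i, (x i - y i).natAbs) = 1

instance {d : ℕ} (x y : Fin d → ℤ) : Decidable (latAdj x y) := by
  unfold latAdj; infer_instance

/-- Unit conductances on `ℤ^d`. -/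
def cZ (d : ℕ) (x y : Fin d → ℤ) : ℝ≥0∞ := if latAdj x y then 1 else 0

/-- Green's function of the simple random walk on `ℤ^d`. -/
def g (d : ℕ) : (Fin d → ℤ) → (Fin d → ℤ) → ℝ≥0∞ := green (cZ d)

/-- Membership in `U_m = ℕ₀^m × ℤ^{d-m}`: the first `m` coordinates are nonnegative. -/
def memU (m : ℕ) {d : ℕ} (x : Fin d → ℤ) : Prop := ∀ i : Fin d, (i : ℕ) < m → 0 ≤ x i

instance (m : ℕ) {d : ℕ} (x : Fin d → ℤ) : Decidable (memU m x) := by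
  unfold memU; infer_instance

/-- Unit conductances on the subgraph `U_m` of `ℤ^d`. -/
def cU (d m : ℕ) (x y : Fin d → ℤ) : ℝ≥0∞ :=
  if memU m x ∧ memU m y ∧ latAdj x y then 1 else 0

/-- Green's function `G_m` of the simple random walk on `U_m = ℕ₀^m × ℤ^{d-m}`. -/
def Gm (d m : ℕ) : (Fin d → ℤ) → (Fin d → ℤ) → ℝ≥0∞ := green (cU d m)

/-- Reflection in the first coordinate: `ȳ = (-y₁, y₂, …, y_d)`. -/
def reflFirst {d : ℕ} (y : Fin d → ℤ) : Fin d → ℤ := fun i => if (i : ℕ) = 0 then -y i else y i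

/-- The first standard basis vector of `ℤ^d`. -/
def e1 (d : ℕ) : Fin d → ℤ := fun i => if (i : ℕ) = 0 then 1 else 0


/-- `n`-step transition probability of the walk with conductances `c` killed outside `A`. -/
def stepKN [DecidableEq V] (c : V → V → ℝ≥0∞) (A : V → Prop) [DecidablePred A] :
    ℕ → V → V → ℝ≥0∞
  | 0, x, y => if x = y then 1 else 0
  | n + 1, x, y => ∑' z, stepKN c A n x z * (if A z ∧ A y then step c z y else 0)

/-- Green's function of the walk with conductances `c` killed when leaving `A`:
the normalized expected number of visits to `y` strictly before exiting `A`, starting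
from `x`; it vanishes unless both `x` and `y` belong to `A`. -/
def greenK [DecidableEq V] (c : V → V → ℝ≥0∞) (A : V → Prop) [DecidablePred A]
    (x y : V) : ℝ≥0∞ :=
  if A x ∧ A y then (piW c y)⁻¹ * ∑' n, stepKN c A n x y else 0

/-- The box `C_N = ([0,N] × [-N,N]^{d-1}) ∩ H`. -/
def memC (N : ℕ) {d : ℕ} (x : Fin d → ℤ) : Prop :=
  (∀ i : Fin d, -(N : ℤ) ≤ x i ∧ x i ≤ (N : ℤ)) ∧ memU 1 x

instance (N : ℕ) {d : ℕ} (x : Fin d → ℤ) : Decidable (memC N x) := by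
  unfold memC; infer_instance

/-- The box `K_N = ([-N-1,N] × [-N,N]^{d-1}) ∩ ℤ^d`. -/
def memK (N : ℕ) {d : ℕ} (x : Fin d → ℤ) : Prop :=
  ∀ i : Fin d, (if (i : ℕ) = 0 then -(N : ℤ) - 1 else -(N : ℤ)) ≤ x i ∧ x i ≤ (N : ℤ)

instance (N : ℕ) {d : ℕ} (x : Fin d → ℤ) : Decidable (memK N x) := by
  unfold memK; infer_instance

variable {W : Type*} [DecidableEq W]

theorem greenK_mul_piW_eq (c : W → W → ℝ≥0∞) (A : W → Prop) [DecidablePred A]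
    (h0 : ∀ z, A z → piW c z ≠ 0) (hT : ∀ z, A z → piW c z ≠ ∞) {x y : W} (hx : A x) (hy : A y) :
    greenK c A x y * piW c y = (if x = y then 1 else 0) + ∑' z, greenK c A x z * c z y := by
  have visits : greenK c A x y * piW c y = ∑' n, stepKN c A n x y := by
    rw [greenK, if_pos ⟨hx, hy⟩, mul_comm, ← mul_assoc,
      ENNReal.mul_inv_cancel (h0 y hy) (hT y hy), one_mul]
  rw [visits, tsum_eq_zero_add' ENNReal.summable]
  congr 1
  simp only [stepKN]
  rw [ENNReal.tsum_comm]
  refine tsum_congr fun z => ?_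
  rw [ENNReal.tsum_mul_right]
  by_cases hz : A z
  · simp only [greenK, hx, hy, hz, and_self, if_true, step, div_eq_mul_inv]
    ring
  · simp [greenK, hz]

/-- The killed Green's function is the smallest supersolution of its defining equation. -/
theorem greenK_le_of_supersolution (c : W → W → ℝ≥0∞) (A : W → Prop) [DecidablePred A]
    (h0 : ∀ z, A z → piW c z ≠ 0) (hT : ∀ z, A z → piW c z ≠ ∞) {x : W} (f : W → ℝ≥0∞)
    (hf : ∀ y, A y → (if x = y then 1 else 0) + ∑' z, (if A z then f z * c z y else 0)
      ≤ f y * piW c y) (y : W) :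
    greenK c A x y ≤ f y := by
  by_cases h : A x ∧ A y
  swap
  · simp [greenK, h]
  obtain ⟨hx, hy⟩ := h
  rw [greenK, if_pos ⟨hx, hy⟩, mul_comm, ← div_eq_mul_inv,
    ENNReal.div_le_iff (h0 y hy) (hT y hy), ENNReal.tsum_eq_iSup_nat]
  refine iSup_le fun n => ?_
  induction n generalizing y with
  | zero => simp
  | succ n ih =>
    rw [Finset.sum_range_succ', add_comm]
    refine le_trans (add_le_add le_rfl ?_) (hf y hy)
    simp only [stepKN]
    rw [← Summable.tsum_finsetSum fun _ _ => ENNReal.summable]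
    refine ENNReal.tsum_le_tsum fun z => ?_
    rw [← Finset.sum_mul]
    by_cases hz : A z
    · rw [if_pos ⟨hz, hy⟩, if_pos hz]
      calc _ ≤ f z * piW c z * step c z y := by gcongr; exact ih z hz
        _ = f z * c z y * (piW c z * (piW c z)⁻¹) := by rw [step, div_eq_mul_inv]; ring
        _ = f z * c z y := by rw [ENNReal.mul_inv_cancel (h0 z hz) (hT z hz), mul_one]
    · simp [hz]

/-- Adding self-loops does not change the normalized killed Green's function. -/
theorem greenK_add_loops (c c' : W → W → ℝ≥0∞) (A : W → Prop) [DecidablePred A] (l : W → ℝ≥0∞)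
    (hc : ∀ x y, c' x y = c x y + if x = y then l x else 0) (hl : ∀ x, l x ≠ ∞)
    (h0 : ∀ z, A z → piW c z ≠ 0) (hT : ∀ z, A z → piW c z ≠ ∞) (x y : W) :
    greenK c A x y = greenK c' A x y := by
  by_cases hxy : A x ∧ A y
  swap
  · simp [greenK, hxy]
  obtain ⟨hx, hy⟩ := hxy
  have hpi (z : W) : piW c' z = piW c z + l z := by
    simp only [piW, hc, ENNReal.tsum_add]
    congr 1
    rw [tsum_eq_single z fun w hw => if_neg hw.symm, if_pos rfl]
  have h0' : ∀ z, A z → piW c' z ≠ 0 := fun z hz => by simp [hpi, h0 z hz]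
  have hT' : ∀ z, A z → piW c' z ≠ ∞ := fun z hz => by simp [hpi, hT z hz, hl]
  have loops (f : W → ℝ≥0∞) (w : W) :
      ∑' z, f z * c' z w = ∑' z, f z * c z w + f w * l w := by
    simp only [hc, mul_add, ENNReal.tsum_add]
    congr 1
    rw [tsum_eq_single w fun z hz => by simp [hz], if_pos rfl]
  have support (b b' : W → W → ℝ≥0∞) (w : W) :
      ∑' z, (if A z then greenK b A x z * b' z w else 0) = ∑' z, greenK b A x z * b' z w :=
    tsum_congr fun z => by by_cases hz : A z <;> simp [greenK, hz]
  apply le_antisymm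
  · refine greenK_le_of_supersolution c A h0 hT _ (fun w hw => ?_) y
    rw [support]
    by_cases hw' : greenK c' A x w = ∞
    · simp [hw', h0 w hw]
    have h := greenK_mul_piW_eq c' A h0' hT' hx hw
    rw [hpi, mul_add, loops, ← add_assoc] at h
    exact ((ENNReal.add_left_inj (ENNReal.mul_ne_top hw' (hl w))).1 h).ge
  · refine greenK_le_of_supersolution c' A h0' hT' _ (fun w hw => ?_) y
    rw [support, loops, hpi, mul_add, greenK_mul_piW_eq c A h0 hT hx hw, add_assoc]

variable {d : ℕ}

/-- The reflection `y ↦ ȳ - e₁` of `ℤ^d` in the hyperplane `x₁ = -1/2`. -/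
def halfRefl (y : Fin d → ℤ) : Fin d → ℤ := reflFirst y - e1 d

theorem halfRefl_apply (y : Fin d → ℤ) (i : Fin d) :
    halfRefl y i = if (i : ℕ) = 0 then -y i - 1 else y i := by
  by_cases h : (i : ℕ) = 0 <;> simp [halfRefl, reflFirst, e1, h]

theorem halfRefl_halfRefl (y : Fin d → ℤ) : halfRefl (halfRefl y) = y := by
  ext i
  by_cases h : (i : ℕ) = 0 <;> simp [halfRefl_apply, h]

/-- `halfRefl` as a permutation of `ℤ^d`. -/
def halfReflEquiv : (Fin d → ℤ) ≃ (Fin d → ℤ) :=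
  ⟨halfRefl, halfRefl, halfRefl_halfRefl, halfRefl_halfRefl⟩

theorem tsum_halfRefl (f : (Fin d → ℤ) → ℝ≥0∞) : ∑' z, f (halfRefl z) = ∑' z, f z :=
  halfReflEquiv.tsum_eq f

theorem memU_one_iff (hd : 0 < d) (x : Fin d → ℤ) : memU 1 x ↔ 0 ≤ x ⟨0, hd⟩ := by
  refine ⟨fun h => h _ Nat.one_pos, fun h i hi => ?_⟩
  rwa [show i = ⟨0, hd⟩ from Fin.ext (by simpa using hi)]

theorem memU_halfRefl (hd : 0 < d) (x : Fin d → ℤ) : memU 1 (halfRefl x) ↔ ¬ memU 1 x := by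
  rw [memU_one_iff hd, memU_one_iff hd, halfRefl_apply, if_pos rfl]
  omega

theorem memK_halfRefl (N : ℕ) (x : Fin d → ℤ) : memK N (halfRefl x) ↔ memK N x := by
  refine forall_congr' fun i => ?_
  rw [halfRefl_apply]
  split_ifs <;> omega

theorem memC_iff (N : ℕ) (x : Fin d → ℤ) : memC N x ↔ memK N x ∧ memU 1 x := by
  refine ⟨fun h => ⟨fun i => ?_, h.2⟩, fun h => ⟨fun i => ?_, h.2⟩⟩
  · have := h.1 i
    split_ifs <;> omega
  · have h1 := h.1 i
    have h2 := h.2 i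
    split_ifs at h1 <;> omega

theorem cZ_halfRefl (x y : Fin d → ℤ) : cZ d (halfRefl x) (halfRefl y) = cZ d x y := by
  have : latAdj (halfRefl x) (halfRefl y) ↔ latAdj x y := by
    unfold latAdj
    rw [Finset.sum_congr rfl fun i _ => ?_]
    rw [halfRefl_apply, halfRefl_apply]
    split_ifs <;> omega
  simp only [cZ, this]

theorem cZ_halfRefl_left (x y : Fin d → ℤ) : cZ d (halfRefl x) y = cZ d x (halfRefl y) := by
  rw [← cZ_halfRefl, halfRefl_halfRefl]

theorem piW_cZ_halfRefl (x : Fin d → ℤ) : piW (cZ d) (halfRefl x) = piW (cZ d) x := by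
  simp only [piW, cZ_halfRefl_left]
  exact tsum_halfRefl _

theorem eq_of_latAdj_halfRefl (hd : 0 < d) {x y : Fin d → ℤ} (hx : memU 1 x) (hy : memU 1 y)
    (h : latAdj x (halfRefl y)) : x = y := by
  rw [memU_one_iff hd] at hx hy
  rw [latAdj, ← Finset.add_sum_erase _ _ (Finset.mem_univ ⟨0, hd⟩), halfRefl_apply,
    if_pos rfl] at h
  have hrest : ∑ i ∈ Finset.univ.erase ⟨0, hd⟩, (x i - halfRefl y i).natAbs = 0 := by omega
  ext i
  by_cases hi : (i : ℕ) = 0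
  · obtain rfl : i = ⟨0, hd⟩ := Fin.ext hi
    omega
  · have := Finset.sum_eq_zero_iff.1 hrest i
      (Finset.mem_erase.2 ⟨fun h => hi (congrArg Fin.val h), Finset.mem_univ i⟩)
    rw [halfRefl_apply, if_neg hi] at this
    omega

theorem piW_cZ_ne_top (x : Fin d → ℤ) : piW (cZ d) x ≠ ∞ := by
  rw [piW, tsum_eq_sum (s := Finset.Icc (x - 1) (x + 1))]
  · refine (ENNReal.sum_lt_top.2 fun y _ => ?_).ne
    unfold cZ
    split_ifs <;> simp
  · intro y hy
    refine if_neg fun h => hy (Finset.mem_Icc.2 ⟨fun i => ?_, fun i => ?_⟩)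
    all_goals
      have := (Finset.single_le_sum (f := fun i => (x i - y i).natAbs)
        (fun _ _ => Nat.zero_le _) (Finset.mem_univ i)).trans_eq h
      simp only [Pi.sub_apply, Pi.add_apply, Pi.one_apply]
      omega

theorem piW_cU_ne_top (m : ℕ) (x : Fin d → ℤ) : piW (cU d m) x ≠ ∞ := by
  refine ne_top_of_le_ne_top (piW_cZ_ne_top x) (ENNReal.tsum_le_tsum fun y => ?_)
  by_cases h : latAdj x y <;> simp [cU, cZ, h]
  split_ifs <;> simp

theorem piW_cU_ne_zero (hd : 0 < d) {m : ℕ} {x : Fin d → ℤ} (hx : memU m x) :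
    piW (cU d m) x ≠ 0 := by
  intro h
  have := ENNReal.tsum_eq_zero.1 h (x + Pi.single ⟨0, hd⟩ 1)
  have hle (i : Fin d) : 0 ≤ (Pi.single ⟨0, hd⟩ 1 : Fin d → ℤ) i := by
    rw [Pi.single_apply]
    split_ifs <;> simp
  have hadj : latAdj x (x + Pi.single ⟨0, hd⟩ 1) := by
    simp [latAdj, Pi.single_apply, apply_ite Int.natAbs]
  rw [cU, if_pos ⟨hx, fun i hi => add_nonneg (hx i hi) (hle i), hadj⟩] at this
  exact one_ne_zero this

/-- Conductances on the half lattice obtained by folding `ℤ^d` along `halfRefl`. -/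
def cFold (d : ℕ) (x y : Fin d → ℤ) : ℝ≥0∞ :=
  if memU 1 x ∧ memU 1 y then cZ d x y + cZ d x (halfRefl y) else 0

theorem cFold_eq_add_loops (hd : 0 < d) (x y : Fin d → ℤ) :
    cFold d x y = cU d 1 x y +
      if x = y then (if memU 1 x ∧ latAdj x (halfRefl x) then 1 else 0) else 0 := by
  by_cases hx : memU 1 x
  swap
  · simp [cFold, cU, hx]
  by_cases hy : memU 1 y
  swap
  · have : x ≠ y := fun h => hy (h ▸ hx)
    simp [cFold, cU, hy, this]
  by_cases hxy : x = y
  · subst hxy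
    simp [cFold, cU, cZ, hx]
  · have : ¬ latAdj x (halfRefl y) := fun h => hxy (eq_of_latAdj_halfRefl hd hx hy h)
    simp [cFold, cU, cZ, hx, hy, hxy, this]

/-- A sum over `ℤ^d` folds to a sum over the half lattice. -/
theorem tsum_fold (hd : 0 < d) (f : (Fin d → ℤ) → ℝ≥0∞) :
    ∑' z, f z = ∑' z, if memU 1 z then f z + f (halfRefl z) else 0 := by
  have split (z : Fin d → ℤ) : f z = (if memU 1 z then f z else 0) +
      if memU 1 (halfRefl z) then f (halfRefl (halfRefl z)) else 0 := by
    rw [halfRefl_halfRefl]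
    by_cases hz : memU 1 z <;> simp [memU_halfRefl hd, hz]
  rw [tsum_congr split, ENNReal.tsum_add,
    tsum_halfRefl fun z => if memU 1 z then f (halfRefl z) else 0, ← ENNReal.tsum_add]
  exact tsum_congr fun z => by split_ifs <;> simp

theorem piW_cFold (hd : 0 < d) {x : Fin d → ℤ} (hx : memU 1 x) :
    piW (cFold d) x = piW (cZ d) x := by
  rw [piW, piW, tsum_fold hd (cZ d x)]
  simp [cFold, hx]

theorem stepKN_cFold (hd : 0 < d) (N n : ℕ) {x y : Fin d → ℤ} (hx : memC N x) (hy : memC N y) :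
    stepKN (cFold d) (memC N) n x y =
      stepKN (cZ d) (memK N) n x y + stepKN (cZ d) (memK N) n x (halfRefl y) := by
  have hyU := ((memC_iff N y).1 hy).2
  have hyK := ((memC_iff N y).1 hy).1
  induction n generalizing y with
  | zero =>
    have : x ≠ halfRefl y := by
      rintro rfl
      exact (memU_halfRefl hd y).1 ((memC_iff N _).1 hx).2 hyU
    simp [stepKN, this]
  | succ n ih =>
    simp only [stepKN]
    rw [← ENNReal.tsum_add]
    refine Eq.trans ?_ (tsum_fold hd _).symm
    refine tsum_congr fun z => ?_
    by_cases hzU : memU 1 z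
    swap
    · simp [memC_iff, hzU]
    by_cases hzK : memK N z
    swap
    · simp [memC_iff, memK_halfRefl, hzK]
    have hz : memC N z := (memC_iff N z).2 ⟨hzK, hzU⟩
    rw [ih hz hzU hzK]
    simp only [hz, hy, hzU, hzK, hyK, memK_halfRefl, and_self, if_true, step, piW_cZ_halfRefl,
      piW_cFold hd hzU, cFold, hyU, cZ_halfRefl_left, halfRefl_halfRefl, ENNReal.add_div]
    ring

theorem greenK_cFold (hd : 0 < d) (N : ℕ) {x y : Fin d → ℤ} (hx : memU 1 x) (hy : memU 1 y) :
    greenK (cFold d) (memC N) x y =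
      greenK (cZ d) (memK N) x y + greenK (cZ d) (memK N) x (halfRefl y) := by
  by_cases h : memK N x ∧ memK N y
  swap
  · have h' : ¬ (memC N x ∧ memC N y) := by simpa [memC_iff, hx, hy] using h
    simp only [greenK, memK_halfRefl, if_neg h, if_neg h', add_zero]
  have hxC : memC N x := (memC_iff N x).2 ⟨h.1, hx⟩
  have hyC : memC N y := (memC_iff N y).2 ⟨h.2, hy⟩
  simp only [greenK, memK_halfRefl, if_pos h, if_pos (And.intro hxC hyC), piW_cFold hd hy,
    piW_cZ_halfRefl, stepKN_cFold hd N _ hxC hyC, ENNReal.tsum_add, mul_add]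

/-- For `d ≥ 3`, `N ∈ ℕ` and `x, y` in the half lattice `H = U_1`, the Green's function of
the walk on `H` killed when leaving `C_N` equals
`g_{K_N}(x,y) + g_{K_N}(x, ȳ - e₁)`, where `g_{K_N}` is the Green's function of the
simple random walk on `ℤ^d` killed when leaving `K_N`. -/
theorem green_killed_half_lattice (d : ℕ) (hd : 3 ≤ d) (N : ℕ) (x y : Fin d → ℤ)
    (hx : memU 1 x) (hy : memU 1 y) :
    greenK (cU d 1) (memC N) x y
      = greenK (cZ d) (memK N) x y + greenK (cZ d) (memK N) x (reflFirst y - e1 d) := by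
  have hd0 : 0 < d := by omega
  rw [greenK_add_loops (cU d 1) (cFold d) (memC N) _ (cFold_eq_add_loops hd0)
    (fun z => by split_ifs <;> simp) (fun z hz => piW_cU_ne_zero hd0 hz.2)
    (fun z _ => piW_cU_ne_top 1 z)]
  exact greenK_cFold hd0 N hx hy

end
end

section
/- Let d ≥ 3 and let g be the Green's function of the simple random walk on ℤ^d. If x, y ∈ ℤ^d satisfy x ⪰ y in the product order, i.e. |x_i| ≥ |y_i| for all 1 ≤ i ≤ d, then g(0, x) ≤ g(0, y). -/
open scoped ENNReal
open Filter

noncomputable section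

variable {V : Type*}

/-- The sum of `f` over the nearest neighbours of `x` in `ℤ^d`. -/
def nbrSum {d : ℕ} (f : (Fin d → ℤ) → ℝ≥0∞) (x : Fin d → ℤ) : ℝ≥0∞ :=
  ∑ i, (f (x + Pi.single i 1) + f (x + Pi.single i (-1)))

lemma latAdj_add_single {d : ℕ} (x : Fin d → ℤ) (i : Fin d) (s : ℤˣ) :
    latAdj (x + Pi.single i (s : ℤ)) x := by
  unfold latAdj
  rw [Finset.sum_eq_single i]
  · rcases Int.units_eq_one_or s with rfl | rfl <;> simp
  · intro j _ hj
    simp [hj]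
  · simp

lemma exists_eq_add_single_of_latAdj {d : ℕ} {z x : Fin d → ℤ} (h : latAdj z x) :
    ∃ (i : Fin d) (s : ℤˣ), x + Pi.single i (s : ℤ) = z := by
  unfold latAdj at h
  obtain ⟨i, hi, hne⟩ : ∃ i ∈ Finset.univ, (z i - x i).natAbs ≠ 0 := by
    by_contra! hc
    rw [Finset.sum_eq_zero hc] at h
    omega
  rw [← Finset.add_sum_erase _ _ hi] at h
  have h0 : ∑ j ∈ Finset.univ.erase i, (z j - x j).natAbs = 0 := by omega
  have h1 : (z i - x i).natAbs = 1 := by omega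
  rw [Finset.sum_eq_zero_iff] at h0
  refine ⟨i, (Int.isUnit_iff_natAbs_eq.2 h1).unit, ?_⟩
  funext j
  by_cases hj : j = i
  · subst hj
    simp
  · have := h0 j (by simp [hj])
    simp [hj]
    omega

lemma add_single_units_injective {d : ℕ} (x : Fin d → ℤ) :
    Function.Injective fun p : Fin d × ℤˣ => x + Pi.single p.1 (p.2 : ℤ) := by
  rintro ⟨i, s⟩ ⟨j, t⟩ h
  have h' : (Pi.single i (s : ℤ) : Fin d → ℤ) = Pi.single j (t : ℤ) := add_left_cancel h
  have hi := congrFun h' i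
  by_cases hij : i = j
  · subst hij
    simpa [Units.ext_iff] using hi
  · simp [hij] at hi

lemma tsum_mul_cZ {d : ℕ} (f : (Fin d → ℤ) → ℝ≥0∞) (x : Fin d → ℤ) :
    ∑' z, f z * cZ d z x = nbrSum f x := by
  rw [← (add_single_units_injective x).tsum_eq]
  · rw [tsum_fintype, Fintype.sum_prod_type]
    refine Finset.sum_congr rfl fun i _ => ?_
    simp [cZ, latAdj_add_single, UnitsInt.univ]
  · intro z hz
    have : latAdj z x := by
      by_contra hn
      simp [cZ, hn] at hz
    obtain ⟨i, s, rfl⟩ := exists_eq_add_single_of_latAdj this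
    exact ⟨(i, s), rfl⟩

lemma cZ_comm {d : ℕ} (x y : Fin d → ℤ) : cZ d x y = cZ d y x := by
  have : latAdj x y ↔ latAdj y x := by
    unfold latAdj
    simp only [← Int.natAbs_neg (x _ - y _), neg_sub]
  simp [cZ, this]

lemma piW_cZ {d : ℕ} (x : Fin d → ℤ) : piW (cZ d) x = 2 * d := by
  have := tsum_mul_cZ (fun _ => 1) x
  simp only [one_mul] at this
  simp only [piW, cZ_comm x, this, nbrSum]
  simp only [one_add_one_eq_two, Finset.sum_const, Finset.card_univ, Fintype.card_fin,
    nsmul_eq_mul, mul_comm]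

lemma tsum_mul_step_cZ {d : ℕ} (f : (Fin d → ℤ) → ℝ≥0∞) (x : Fin d → ℤ) :
    ∑' z, f z * step (cZ d) z x = nbrSum f x / (2 * d) := by
  simp only [step, piW_cZ, div_eq_mul_inv, ← mul_assoc]
  rw [ENNReal.tsum_mul_right, tsum_mul_cZ]

lemma nbrSum_mono {d : ℕ} {f f' : (Fin d → ℤ) → ℝ≥0∞} (h : f ≤ f') (x : Fin d → ℤ) :
    nbrSum f x ≤ nbrSum f' x :=
  Finset.sum_le_sum fun _ _ => add_le_add (h _) (h _)

/-- Antitonicity with respect to the product order on absolute values of coordinates. -/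
def AbsAntitone {d : ℕ} (f : (Fin d → ℤ) → ℝ≥0∞) : Prop :=
  ∀ x y : Fin d → ℤ, (∀ i, |y i| ≤ |x i|) → f x ≤ f y

lemma AbsAntitone.lazy_coordinate {d : ℕ} {f : (Fin d → ℤ) → ℝ≥0∞} (hf : AbsAntitone f)
    {x y : Fin d → ℤ} (h : ∀ i, |y i| ≤ |x i|) (i : Fin d) :
    2 * f x + (f (x + Pi.single i 1) + f (x + Pi.single i (-1))) ≤
      2 * f y + (f (y + Pi.single i 1) + f (y + Pi.single i (-1))) := by
  have key : ∀ s t : ℤ, |y i + t| ≤ |x i + s| →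
      f (x + Pi.single i s) ≤ f (y + Pi.single i t) := by
    refine fun s t hst => hf _ _ fun j => ?_
    by_cases hj : j = i
    · subst hj
      simpa using hst
    · simpa [hj] using h j
  have hx := key (s := 0)
  have hy := key (t := 0)
  simp only [Pi.single_zero, add_zero] at hx hy
  rcases (h i).eq_or_lt with he | hlt
  · refine add_le_add (mul_le_mul_right (hf _ _ h) _) ?_
    rcases abs_eq_abs.1 he with he | he
    · exact add_le_add (key _ _ (by simp [he])) (key _ _ (by simp [he]))
    · rw [add_comm (f (y + _))]
      exact add_le_add (key _ _ (by rw [he, ← abs_neg]; ring_nf; rfl))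
        (key _ _ (by rw [he, ← abs_neg]; ring_nf; rfl))
  · rw [add_comm, two_mul, two_mul]
    refine add_le_add (add_le_add (hy _ ?_) (hy _ ?_)) (add_le_add (hx _ ?_) (hx _ ?_)) <;> grind

/-- The affine map whose least fixed point is the Green kernel of the lazy walk from `0`,
normalised so that it agrees with that of the simple random walk. -/
def lazyMap (d : ℕ) : ((Fin d → ℤ) → ℝ≥0∞) →o ((Fin d → ℤ) → ℝ≥0∞) where
  toFun f x := (if 0 = x then 1 else 0) / 2 + (2 * d * f x + nbrSum f x) / (4 * d)
  monotone' f f' h x := by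
    dsimp only
    gcongr
    · exact h x
    · exact nbrSum_mono h x

lemma AbsAntitone.lazyMap {d : ℕ} {f : (Fin d → ℤ) → ℝ≥0∞} (hf : AbsAntitone f) :
    AbsAntitone (lazyMap d f) := by
  intro x y h
  refine add_le_add (ENNReal.div_le_div_right ?_ _) (ENNReal.div_le_div_right ?_ _)
  · split_ifs with hx hy
    · rfl
    · refine absurd (funext fun i => ?_) hy
      simpa [← hx, eq_comm] using h i
    all_goals simp
  · have (z : Fin d → ℤ) : 2 * d * f z + nbrSum f z =
        ∑ i, (2 * f z + (f (z + Pi.single i 1) + f (z + Pi.single i (-1)))) := by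
      rw [Finset.sum_add_distrib, nbrSum]
      simp only [Finset.sum_const, Finset.card_univ, Fintype.card_fin, nsmul_eq_mul]
      ring
    rw [this, this]
    exact Finset.sum_le_sum fun i _ => hf.lazy_coordinate h i

lemma absAntitone_lfp_lazyMap (d : ℕ) : AbsAntitone (lazyMap d).lfp := by
  refine OrderHom.lfp_induction _ (fun f hf _ => hf.lazyMap) fun s hs x y h => ?_
  simp only [sSup_apply]
  exact iSup_mono fun f => hs f f.2 x y h

lemma lazyMap_apply_eq {d : ℕ} (hd : d ≠ 0) (f : (Fin d → ℤ) → ℝ≥0∞) (x : Fin d → ℤ) :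
    lazyMap d f x = f x / 2 + ((if 0 = x then 1 else 0) + nbrSum f x / (2 * d)) / 2 := by
  have hd0 : (d : ℝ≥0∞) ≠ 0 := by exact_mod_cast hd
  have h2d : (2 * d : ℝ≥0∞) ≠ 0 := by simp [hd]
  have h2dt : (2 * d : ℝ≥0∞) ≠ ∞ := by finiteness
  have h4 : (4 * d : ℝ≥0∞)⁻¹ = (2 * d : ℝ≥0∞)⁻¹ * 2⁻¹ := by
    rw [← ENNReal.mul_inv (by simp) (by simp)]
    congr 1
    ring
  change _ / 2 + (2 * d * f x + nbrSum f x) / (4 * d) = _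
  simp only [div_eq_mul_inv, h4, add_mul]
  have : 2 * (d : ℝ≥0∞) * f x * ((2 * d : ℝ≥0∞)⁻¹ * 2⁻¹) = f x * 2⁻¹ := by
    rw [mul_comm (2 * (d : ℝ≥0∞)) (f x), mul_assoc, ← mul_assoc (2 * (d : ℝ≥0∞)),
      ENNReal.mul_inv_cancel h2d h2dt, one_mul]
  rw [this]
  ring

lemma lfp_lazyMap_superharmonic {d : ℕ} (hd : d ≠ 0) (x : Fin d → ℤ) :
    (if 0 = x then 1 else 0) + nbrSum (lazyMap d).lfp x / (2 * d) ≤ (lazyMap d).lfp x := by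
  have hfix := congrFun (lazyMap d).map_lfp x
  rw [lazyMap_apply_eq hd] at hfix
  set a := (lazyMap d).lfp x
  by_cases ha : a = ∞
  · simp [ha]
  · nth_rw 2 [← ENNReal.add_halves a] at hfix
    have h2 := (ENNReal.add_right_inj (ENNReal.div_ne_top ha two_ne_zero)).1 hfix
    exact ((ENNReal.mul_left_inj (c := 2⁻¹) (by simp) (by simp)).1 h2).le

lemma sum_range_stepN_succ {d : ℕ} (N : ℕ) (x : Fin d → ℤ) :
    ∑ n ∈ Finset.range (N + 1), stepN (cZ d) n 0 x =
      (if 0 = x then 1 else 0) +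
        nbrSum (fun z => ∑ n ∈ Finset.range N, stepN (cZ d) n 0 z) x / (2 * d) := by
  rw [Finset.sum_range_succ', add_comm, ← tsum_mul_step_cZ]
  simp only [stepN, Finset.sum_mul]
  rw [Summable.tsum_finsetSum fun _ _ => ENNReal.summable]

lemma tsum_stepN_eq {d : ℕ} (x : Fin d → ℤ) :
    ∑' n, stepN (cZ d) n 0 x =
      (if 0 = x then 1 else 0) + nbrSum (fun z => ∑' n, stepN (cZ d) n 0 z) x / (2 * d) := by
  rw [tsum_eq_zero_add' ENNReal.summable, ← tsum_mul_step_cZ]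
  simp only [stepN, ← ENNReal.tsum_mul_right]
  rw [ENNReal.tsum_comm]

lemma lfp_lazyMap_eq {d : ℕ} (hd : d ≠ 0) :
    (lazyMap d).lfp = fun x => ∑' n, stepN (cZ d) n 0 x := by
  apply le_antisymm
  · refine OrderHom.lfp_le _ fun x => ?_
    rw [lazyMap_apply_eq hd, ← tsum_stepN_eq, ENNReal.add_halves]
  · refine fun x => ENNReal.tsum_le_of_sum_range_le fun N => ?_
    induction N generalizing x with
    | zero => simp
    | succ N ih =>
      rw [sum_range_stepN_succ]
      refine le_trans ?_ (lfp_lazyMap_superharmonic hd x)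
      gcongr
      exact nbrSum_mono ih x

/-- **Monotonicity of `g(0,·)` with respect to the product order.** For `d ≥ 3`, if
`x ⪰ y`, i.e. `|x_i| ≥ |y_i|` for all `i`, then `g(0,x) ≤ g(0,y)`. -/
theorem green_mono_product_order (d : ℕ) (hd : 3 ≤ d) (x y : Fin d → ℤ)
    (h : ∀ i : Fin d, |y i| ≤ |x i|) :
    g d 0 x ≤ g d 0 y := by
  simp only [g, green, piW_cZ]
  refine mul_le_mul_right ?_ _
  have := absAntitone_lfp_lazyMap d
  rw [lfp_lazyMap_eq (by omega)] at this
  exact this x y h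

end
end
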